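/- arXiv:2004.12654 — 4 statements merged into one kernel-verified Lean document; each statement's English description precedes it below -/
import Mathlib

section
/- The sequence (C_n)_{n≥1} defined by C_n = 2^n n! n^{−1/4} / √((2n)!) is strictly decreasing, converges to π^{1/4} as n → ∞, and satisfies π^{1/4} < C_n ≤ e/(2π)^{1/4} for every n ≥ 1. -/
open MeasureTheory Real Filter

noncomputable section

/-- The orthonormal basis functions of the Gaussian RKHS. -/
def phi (ℓ : ℝ) (m : ℕ) (x : ℝ) : ℝ :=
  x ^ m * Real.exp (-x ^ 2 / (2 * ℓ ^ 2)) / (ℓ ^ m * Real.sqrt (Nat.factorial m))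

/-- The univariate Gaussian integral functional. -/
def Igauss (α : ℝ) (f : ℝ → ℝ) : ℝ :=
  (Real.sqrt (2 * Real.pi) * α)⁻¹ * ∫ x : ℝ, f x * Real.exp (-x ^ 2 / (2 * α ^ 2))

/-- β = αℓ/√(α² + ℓ²). -/
def betaP (α ℓ : ℝ) : ℝ := α * ℓ / Real.sqrt (α ^ 2 + ℓ ^ 2)

/-- C_n = 2^n n! n^{−1/4} / √((2n)!). -/
def Cseq (n : ℕ) : ℝ :=
  2 ^ n * (Nat.factorial n : ℝ) * (n : ℝ) ^ (-(1 / 4 : ℝ)) / Real.sqrt (Nat.factorial (2 * n))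

/-- ω_γ = 2γ²/(1 + 2γ² + √(1+4γ²)). -/
def omegaP (γ : ℝ) : ℝ := 2 * γ ^ 2 / (1 + 2 * γ ^ 2 + Real.sqrt (1 + 4 * γ ^ 2))

/-- C̄_n(γ). -/
def Cbar (γ : ℝ) (n : ℕ) : ℝ :=
  Real.sqrt (2 * (1 + 4 * γ ^ 2) ^ ((1 : ℝ) / 4) /
      ((1 + 2 * γ ^ 2 + Real.sqrt (1 + 4 * γ ^ 2)) * Real.exp 1)) *
    ((Nat.factorial n : ℝ) / (Nat.factorial (2 * n) : ℝ)) *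
    (Real.exp 1 / (4 * (n : ℝ))) ^ (-(n : ℤ))

/-- `x`, `w` are the nodes and weights of the n-point Gauss–Hermite rule: the nodes are the
n distinct roots of the probabilists' Hermite polynomial H_n, the weights are positive, and
the rule integrates exactly all polynomials of degree at most 2n−1 against the standard
Gaussian weight. -/
def IsGaussHermite (n : ℕ) (x w : Fin n → ℝ) : Prop :=
  Function.Injective x ∧
  (∀ i, Polynomial.aeval (x i) (Polynomial.hermite n) = 0) ∧
  (∀ i, 0 < w i) ∧
  ∀ p : Polynomial ℝ, p.natDegree ≤ 2 * n - 1 →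
    ∑ i, w i * p.eval (x i)
      = (Real.sqrt (2 * Real.pi))⁻¹ * ∫ t : ℝ, p.eval t * Real.exp (-t ^ 2 / 2)

/-- The scaled Gauss–Hermite rule Q_{α,ℓ,n}^{GH}. -/
def QGH (α ℓ : ℝ) {n : ℕ} (x w : Fin n → ℝ) (f : ℝ → ℝ) : ℝ :=
  betaP α ℓ / α *
    ∑ i, w i * Real.exp (betaP α ℓ ^ 2 * x i ^ 2 / (2 * ℓ ^ 2)) * f (betaP α ℓ * x i)

/-- Membership in the unit ball of the Gaussian RKHS H(K_ℓ). -/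
def InBall (ℓ : ℝ) (f : ℝ → ℝ) : Prop :=
  ∃ c : ℕ → ℝ, (∀ x, HasSum (fun m => c m * phi ℓ m x) (f x)) ∧
    Summable (fun m => c m ^ 2) ∧ (∑' m, c m ^ 2) ≤ 1

/-- Worst-case error of a quadrature functional over the unit ball of H(K_ℓ). -/
def wce1 (α ℓ : ℝ) (Q : (ℝ → ℝ) → ℝ) : ℝ :=
  sSup {e : ℝ | ∃ f : ℝ → ℝ, InBall ℓ f ∧ e = |Igauss α f - Q f|}

/-- The n-th minimal worst-case error (univariate). -/
def minErr1 (α ℓ : ℝ) (n : ℕ) : ℝ :=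
  ⨅ p : (Fin n → ℝ) × (Fin n → ℝ), wce1 α ℓ fun f => ∑ i, p.2 i * f (p.1 i)

/-- The multivariate Gaussian integral functional. -/
def IgaussD {d : ℕ} (α : Fin d → ℝ) (f : (Fin d → ℝ) → ℝ) : ℝ :=
  ∫ x : Fin d → ℝ,
    f x * ∏ i, (Real.sqrt (2 * Real.pi) * α i)⁻¹ * Real.exp (-(x i) ^ 2 / (2 * α i ^ 2))

/-- Membership in the unit ball of the tensor-product Gaussian RKHS H(K_ℓ), ℓ ∈ ℝ^d. -/
def InBallD {d : ℕ} (ℓ : Fin d → ℝ) (f : (Fin d → ℝ) → ℝ) : Prop :=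
  ∃ c : (Fin d → ℕ) → ℝ,
    (∀ x, HasSum (fun m => c m * ∏ i, phi (ℓ i) (m i) (x i)) (f x)) ∧
    Summable (fun m => c m ^ 2) ∧ (∑' m, c m ^ 2) ≤ 1

/-- Worst-case error of a multivariate quadrature functional. -/
def wceD {d : ℕ} (α ℓ : Fin d → ℝ) (Q : ((Fin d → ℝ) → ℝ) → ℝ) : ℝ :=
  sSup {e : ℝ | ∃ f, InBallD ℓ f ∧ e = |IgaussD α f - Q f|}

/-- The N-th minimal worst-case error in dimension d. -/
def minErrD {d : ℕ} (α ℓ : Fin d → ℝ) (N : ℕ) : ℝ :=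
  ⨅ p : (Fin N → (Fin d → ℝ)) × (Fin N → ℝ), wceD α ℓ fun f => ∑ i, p.2 i * f (p.1 i)

/-- The tensor-product scaled Gauss–Hermite rule. -/
def QGHD {d : ℕ} (α ℓ : Fin d → ℝ) (n : Fin d → ℕ)
    (x w : ∀ j, Fin (n j) → ℝ) (f : (Fin d → ℝ) → ℝ) : ℝ :=
  ∑ i : ∀ j, Fin (n j),
    (∏ j, betaP (α j) (ℓ j) / α j * w j (i j) *
        Real.exp (betaP (α j) (ℓ j) ^ 2 * x j (i j) ^ 2 / (2 * ℓ j ^ 2))) *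
      f fun j => betaP (α j) (ℓ j) * x j (i j)

/-- The power function of a finite point set (univariate). -/
def power1 (ℓ : ℝ) (X : Finset ℝ) (x : ℝ) : ℝ :=
  sSup {v : ℝ | ∃ f, InBall ℓ f ∧ (∀ y ∈ X, f y = 0) ∧ v = f x}

/-- Fill distance of X on Ω (univariate). -/
def fillDist1 (X : Finset ℝ) (Ω : Set ℝ) : ℝ :=
  sSup {h : ℝ | ∃ x ∈ Ω, h = sInf {r : ℝ | ∃ y ∈ X, y ∈ Ω ∧ r = |x - y|}}

/-- Euclidean distance on ℝ^d. -/
def eucDist {d : ℕ} (x y : Fin d → ℝ) : ℝ := Real.sqrt (∑ i, (x i - y i) ^ 2)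

/-- The power function of a finite point set in ℝ^d for the isotropic Gaussian kernel. -/
def powerD {d : ℕ} (ℓ : ℝ) (X : Finset (Fin d → ℝ)) (x : Fin d → ℝ) : ℝ :=
  sSup {v : ℝ | ∃ f, InBallD (fun _ => ℓ) f ∧ (∀ y ∈ X, f y = 0) ∧ v = f x}

/-- Fill distance of X on Ω ⊂ ℝ^d (Euclidean). -/
def fillDistD {d : ℕ} (X : Finset (Fin d → ℝ)) (Ω : Set (Fin d → ℝ)) : ℝ :=
  sSup {h : ℝ | ∃ x ∈ Ω, h = sInf {r : ℝ | ∃ y ∈ X, y ∈ Ω ∧ r = eucDist x y}}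

/-- Worst-case error of the optimal-weight (kernel quadrature) rule with nodes X (univariate). -/
def eopt1 (α ℓ : ℝ) (X : Finset ℝ) : ℝ :=
  ⨅ w : ℝ → ℝ, wce1 α ℓ fun f => ∑ y ∈ X, w y * f y

/-- Worst-case error of the optimal-weight rule with nodes X ⊂ ℝ^d. -/
def eoptD {d : ℕ} (α ℓ : Fin d → ℝ) (X : Finset (Fin d → ℝ)) : ℝ :=
  ⨅ w : (Fin d → ℝ) → ℝ, wceD α ℓ fun f => ∑ y ∈ X, w y * f y

/-- The point sets X_k = ∪_{m=1}^k (Y_{k−m+1}^{m,+} ∪ Y_{k−m+1}^{m,−}). -/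
def Xk (Y : ℕ → Finset ℝ) (k : ℕ) : Finset ℝ :=
  (Finset.Icc 1 k).biUnion fun m =>
    ((Y (k - m + 1)).image fun x => x + (m : ℝ) - 1) ∪
      ((Y (k - m + 1)).image fun x => x - (m : ℝ))


theorem Cseq_nonneg (n : ℕ) : 0 ≤ Cseq n := by
  unfold Cseq
  positivity

theorem Cseq_pow_four (n : ℕ) :
    Cseq n ^ 4 = 2 ^ (4 * n) * (Nat.factorial n : ℝ) ^ 4 /
      ((Nat.factorial (2 * n) : ℝ) ^ 2 * n) := by
  have h1 : ((n : ℝ) ^ (-(1 / 4 : ℝ))) ^ 4 = (n : ℝ)⁻¹ := by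
    rw [← Real.rpow_natCast, ← Real.rpow_mul n.cast_nonneg, ← Real.rpow_neg_one]
    norm_num
  have h2 : Real.sqrt (Nat.factorial (2 * n)) ^ 4 = (Nat.factorial (2 * n) : ℝ) ^ 2 := by
    rw [show 4 = 2 * 2 from rfl, pow_mul, Real.sq_sqrt (Nat.cast_nonneg _)]
  rw [Cseq, div_pow, mul_pow, mul_pow, h1, h2, ← pow_mul, mul_comm n 4, ← div_eq_mul_inv,
    div_div, mul_comm (n : ℝ)]

theorem Cseq_succ_lt {n : ℕ} (hn : 1 ≤ n) : Cseq (n + 1) < Cseq n := by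
  refine lt_of_pow_lt_pow_left₀ 4 (Cseq_nonneg n) ?_
  have hn' : (0 : ℝ) < n := by exact_mod_cast hn
  have hratio : Cseq (n + 1) ^ 4 =
      Cseq n ^ 4 * (4 * (n * (n + 1)) / (2 * n + 1) ^ 2) := by
    rw [Cseq_pow_four, Cseq_pow_four, show 2 * (n + 1) = 2 * n + 1 + 1 by ring,
      Nat.factorial_succ n, Nat.factorial_succ (2 * n + 1), Nat.factorial_succ (2 * n)]
    have := Nat.factorial_ne_zero (2 * n)
    push_cast
    field_simp
    ring
  have hpos : 0 < Cseq n ^ 4 := by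
    rw [Cseq_pow_four]
    positivity
  rw [hratio]
  refine mul_lt_of_lt_one_right hpos ?_
  rw [div_lt_one (by positivity)]
  nlinarith

theorem Cseq_strictAntiOn : StrictAntiOn Cseq {n : ℕ | 1 ≤ n} := by
  intro a ha b _ hab
  induction b, hab using Nat.le_induction with
  | base => exact Cseq_succ_lt ha
  | succ k hk ih =>
    have hk' : 1 ≤ k := le_trans ha (by omega)
    exact (Cseq_succ_lt hk').trans (ih hk')

theorem tendsto_Cseq : Tendsto Cseq atTop (nhds (Real.pi ^ ((1 : ℝ) / 4))) := by
  have hW : Tendsto (fun n : ℕ => Real.Wallis.W n * (2 + 1 / (n : ℝ))) atTop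
      (nhds (Real.pi / 2 * (2 + 0))) :=
    Real.Wallis.tendsto_W_nhds_pi_div_two.mul
      (tendsto_const_nhds.add tendsto_one_div_atTop_nhds_zero_nat)
  rw [show Real.pi / 2 * (2 + 0) = Real.pi by ring] at hW
  refine (hW.rpow_const (p := 1 / 4) (Or.inl Real.pi_ne_zero)).congr' ?_
  filter_upwards [eventually_ge_atTop 1] with n hn
  have hn' : (0 : ℝ) < n := by exact_mod_cast hn
  have h : Real.Wallis.W n * (2 + 1 / (n : ℝ)) = Cseq n ^ 4 := by
    rw [Cseq_pow_four, Real.Wallis.W_eq_factorial_ratio]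
    have := Nat.factorial_ne_zero (2 * n)
    field_simp
  rw [h, ← Real.rpow_natCast, ← Real.rpow_mul (Cseq_nonneg n)]
  norm_num

theorem pi_rpow_lt_Cseq {n : ℕ} (hn : 1 ≤ n) : Real.pi ^ ((1 : ℝ) / 4) < Cseq n := by
  refine lt_of_le_of_lt (le_of_tendsto tendsto_Cseq ?_) (Cseq_succ_lt hn)
  filter_upwards [eventually_ge_atTop (n + 1)] with m hm
  exact Cseq_strictAntiOn.antitoneOn (Nat.le_add_left 1 n) (le_trans (by omega) hm) hm

theorem Cseq_one_le : Cseq 1 ≤ Real.exp 1 / (2 * Real.pi) ^ ((1 : ℝ) / 4) := by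
  refine le_of_pow_le_pow_left₀ four_ne_zero (by positivity) ?_
  have h : ((2 * Real.pi) ^ ((1 : ℝ) / 4)) ^ 4 = 2 * Real.pi := by
    rw [← Real.rpow_natCast, ← Real.rpow_mul (by positivity)]
    norm_num
  rw [Cseq_pow_four, div_pow, h, le_div_iff₀ (by positivity)]
  have he : (2.7 : ℝ) ^ 4 ≤ Real.exp 1 ^ 4 :=
    pow_le_pow_left₀ (by norm_num) (by linarith [Real.exp_one_gt_d9]) 4
  norm_num [Nat.factorial] at he ⊢
  linarith [Real.pi_lt_four]

/-- the sequence C_n is strictly decreasing on n ≥ 1, tends to π^{1/4}, and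
satisfies π^{1/4} < C_n ≤ e/(2π)^{1/4} for all n ≥ 1. -/
theorem stmt0 :
    StrictAntiOn Cseq {n : ℕ | 1 ≤ n} ∧
    Tendsto Cseq atTop (nhds (Real.pi ^ ((1 : ℝ) / 4))) ∧
    ∀ n : ℕ, 1 ≤ n →
      Real.pi ^ ((1 : ℝ) / 4) < Cseq n ∧
      Cseq n ≤ Real.exp 1 / (2 * Real.pi) ^ ((1 : ℝ) / 4) := by
  refine ⟨Cseq_strictAntiOn, tendsto_Cseq, fun n hn => ⟨pi_rpow_lt_Cseq hn, ?_⟩⟩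
  exact (Cseq_strictAntiOn.antitoneOn (le_refl 1) hn hn).trans Cseq_one_le

end
end

section
/- For every α, ℓ > 0, every n ≥ 1 and every integer m with 0 ≤ m ≤ 2n−1, the scaled Gauss–Hermite rule is exact on the basis function φ_{ℓ,m}: Q_{α,ℓ,n}^{GH}(φ_{ℓ,m}) = I_α(φ_{ℓ,m}). -/
open MeasureTheory Real Filter

noncomputable section

theorem betaP_pos {α ℓ : ℝ} (hα : 0 < α) (hℓ : 0 < ℓ) : 0 < betaP α ℓ := by
  unfold betaP
  positivity

theorem betaP_sq (α ℓ : ℝ) : betaP α ℓ ^ 2 = α ^ 2 * ℓ ^ 2 / (α ^ 2 + ℓ ^ 2) := by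
  rw [betaP, div_pow, Real.sq_sqrt (by positivity), mul_pow]

/-- On the rescaled variable `x = β t`, the basis function times the Gaussian weight is a monomial
times the standard Gaussian weight. -/
theorem phi_mul_exp_betaP {α ℓ : ℝ} (hα : 0 < α) (hℓ : 0 < ℓ) (m : ℕ) (t : ℝ) :
    phi ℓ m (betaP α ℓ * t) * Real.exp (-(betaP α ℓ * t) ^ 2 / (2 * α ^ 2))
      = betaP α ℓ ^ m / (ℓ ^ m * Real.sqrt (Nat.factorial m)) *
        (t ^ m * Real.exp (-t ^ 2 / 2)) := by
  have hexp : Real.exp (-t ^ 2 / 2) = Real.exp (-(betaP α ℓ * t) ^ 2 / (2 * ℓ ^ 2)) *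
      Real.exp (-(betaP α ℓ * t) ^ 2 / (2 * α ^ 2)) := by
    rw [← Real.exp_add, mul_pow, betaP_sq]
    congr 1
    field_simp
    ring
  rw [hexp, phi]
  ring

theorem exp_mul_phi_betaP (α ℓ : ℝ) (m : ℕ) (t : ℝ) :
    Real.exp (betaP α ℓ ^ 2 * t ^ 2 / (2 * ℓ ^ 2)) * phi ℓ m (betaP α ℓ * t)
      = betaP α ℓ ^ m / (ℓ ^ m * Real.sqrt (Nat.factorial m)) * t ^ m := by
  have hexp : Real.exp (betaP α ℓ ^ 2 * t ^ 2 / (2 * ℓ ^ 2)) *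
      Real.exp (-(betaP α ℓ * t) ^ 2 / (2 * ℓ ^ 2)) = 1 := by
    rw [← Real.exp_add, mul_pow, neg_div, add_neg_cancel, Real.exp_zero]
  rw [phi]
  linear_combination
    (betaP α ℓ * t) ^ m / (ℓ ^ m * Real.sqrt (Nat.factorial m)) * hexp

/-- The Gaussian integral of a basis function as a standard Gaussian moment. -/
theorem Igauss_phi {α ℓ : ℝ} (hα : 0 < α) (hℓ : 0 < ℓ) (m : ℕ) :
    Igauss α (phi ℓ m)
      = betaP α ℓ / α * (betaP α ℓ ^ m / (ℓ ^ m * Real.sqrt (Nat.factorial m))) *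
        ((Real.sqrt (2 * Real.pi))⁻¹ * ∫ t : ℝ, t ^ m * Real.exp (-t ^ 2 / 2)) := by
  have hβ := betaP_pos hα hℓ
  have hsub := Measure.integral_comp_mul_left
    (fun y : ℝ => phi ℓ m y * Real.exp (-y ^ 2 / (2 * α ^ 2))) (betaP α ℓ)
  simp only [phi_mul_exp_betaP hα hℓ, integral_const_mul, smul_eq_mul,
    abs_of_pos (inv_pos.mpr hβ)] at hsub
  rw [inv_mul_eq_div, eq_div_iff hβ.ne'] at hsub
  rw [Igauss, ← hsub, mul_inv]
  ring

/-- the scaled Gauss–Hermite rule is exact on φ_{ℓ,m} for 0 ≤ m ≤ 2n−1. -/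
theorem stmt1 (α ℓ : ℝ) (hα : 0 < α) (hℓ : 0 < ℓ) (n : ℕ) (hn : 1 ≤ n)
    (x w : Fin n → ℝ) (hGH : IsGaussHermite n x w)
    (m : ℕ) (hm : m ≤ 2 * n - 1) :
    QGH α ℓ x w (phi ℓ m) = Igauss α (phi ℓ m) := by
  have hmoment := hGH.2.2.2 (Polynomial.X ^ m) (by simpa using hm)
  simp only [Polynomial.eval_pow, Polynomial.eval_X] at hmoment
  rw [Igauss_phi hα hℓ, ← hmoment, QGH, mul_assoc]
  congr 1
  rw [Finset.mul_sum]
  refine Finset.sum_congr rfl fun i _ => ?_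
  rw [mul_assoc, exp_mul_phi_betaP]
  ring

end
end

section
/- For every α, ℓ > 0 and n ≥ 1, the squared RKHS norm of the representer of the scaled Gauss–Hermite rule is at most that of the integral representer; concretely, with β = αℓ/√(α²+ℓ²), scaled nodes x_i^s = β x_{n,i} and scaled weights w_i^s = (β/α) w_{n,i} exp(β² x_{n,i}²/(2ℓ²)), one has Σ_{i=1}^n Σ_{j=1}^n w_i^s w_j^s K_ℓ(x_i^s, x_j^s) ≤ (1 + 2α²/ℓ²)^{−1/2}, and moreover (1/(2π α²)) ∫_ℝ ∫_ℝ K_ℓ(x,y) exp(−x²/(2α²)) exp(−y²/(2α²)) dx dy = (1 + 2α²/ℓ²)^{−1/2}, with the intermediate identity (1/(√(2π) α)) ∫_ℝ K_ℓ(y,x) exp(−y²/(2α²)) dy = √(ℓ²/(α²+ℓ²)) exp(−x²/(2(α²+ℓ²))) for every x ∈ ℝ. -/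
open MeasureTheory Real Filter

noncomputable section

open Polynomial in
/-- Hermite polynomials have the parity of their degree. -/
lemma aeval_neg_hermite (n : ℕ) (t : ℝ) :
    aeval (-t) (hermite n) = (-1) ^ n * aeval t (hermite n) := by
  rw [aeval_eq_sum_range, aeval_eq_sum_range, Finset.mul_sum]
  refine Finset.sum_congr rfl fun i _ => ?_
  rcases Nat.even_or_odd (n + i) with h | h
  · have h1 : (-1 : ℝ) ^ i = (-1) ^ n := by
      rcases Nat.even_or_odd n with hn | hn
      · rw [hn.neg_one_pow, ((Nat.even_add.1 h).1 hn).neg_one_pow]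
      · have hi : Odd i := by
          rw [← Nat.not_even_iff_odd] at hn ⊢
          exact fun hi => hn ((Nat.even_add.1 h).2 hi)
        rw [hn.neg_one_pow, hi.neg_one_pow]
    rw [neg_pow, h1, mul_smul_comm]
  · rw [coeff_hermite_of_odd_add h]
    simp

open Polynomial in
/-- The Hermite polynomial is the nodal polynomial of the Gauss–Hermite nodes. -/
lemma IsGaussHermite.aeval_hermite {n : ℕ} {x w : Fin n → ℝ} (h : IsGaussHermite n x w)
    (t : ℝ) : aeval t (hermite n) = ∏ i, (t - x i) := by
  have hm : ((hermite n).map (Int.castRingHom ℝ)).Monic := (hermite_monic n).map _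
  have hd : ((hermite n).map (Int.castRingHom ℝ)).degree = n := by
    rw [(hermite_monic n).degree_map, degree_hermite]
  have key : (hermite n).map (Int.castRingHom ℝ) = Lagrange.nodal Finset.univ x := by
    refine eq_of_degree_sub_lt_of_eval_index_eq Finset.univ h.1.injOn ?_ fun i _ => ?_
    · have := degree_sub_lt_left (p := (hermite n).map (Int.castRingHom ℝ))
        (q := Lagrange.nodal Finset.univ x) (by simp [hd]) hm.ne_zero
        (by rw [hm.leadingCoeff, (Lagrange.nodal_monic).leadingCoeff])
      simpa [hd] using this
    · rw [Lagrange.eval_nodal_at_node (Finset.mem_univ i), eval_map, ← h.2.1 i]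
      rfl
  have h2 := congrArg (eval t) key
  rw [Lagrange.eval_nodal, eval_map] at h2
  exact h2

/-- The squared nodes are the roots of a polynomial in `t ^ 2` that is a perfect square. -/
lemma IsGaussHermite.prod_sq_sub_nonneg {n : ℕ} {x w : Fin n → ℝ} (h : IsGaussHermite n x w)
    (t : ℝ) : 0 ≤ ∏ i, (t ^ 2 - x i ^ 2) := by
  have h1 : ∏ i, (t ^ 2 - x i ^ 2) = (∏ i, (t - x i)) ^ 2 := by
    have h2 : ∏ i, (t ^ 2 - x i ^ 2) = (-1) ^ n * ((∏ i, (t - x i)) * ∏ i, (-t - x i)) := by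
      have : (-1 : ℝ) ^ n = ∏ _i : Fin n, (-1 : ℝ) := by simp
      rw [this, ← Finset.prod_mul_distrib, ← Finset.prod_mul_distrib]
      exact Finset.prod_congr rfl fun i _ => by ring
    rw [h2, ← h.aeval_hermite t, ← h.aeval_hermite (-t), aeval_neg_hermite]
    have h3 : ((-1 : ℝ) ^ n) * (-1) ^ n = 1 := by rw [← mul_pow]; simp
    linear_combination (Polynomial.aeval t (Polynomial.hermite n)) ^ 2 * h3
  rw [h1]
  positivity

open Polynomial in
/-- Division of a polynomial with nonnegative coefficients by a product of linear factors
with nonnegative roots leaves a quotient with nonnegative coefficients. -/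
lemma exists_quotient_coeff_nonneg {ι : Type*} (s : Finset ι) (a : ι → ℝ)
    (ha : ∀ i, 0 ≤ a i) (f : ℝ[X]) (hf : ∀ k, 0 ≤ f.coeff k) :
    ∃ q r : ℝ[X], (∀ k, 0 ≤ q.coeff k) ∧ r.degree < s.card ∧
      f = q * (∏ i ∈ s, (X - C (a i))) + r := by
  classical
  induction s using Finset.induction_on generalizing f with
  | empty => exact ⟨f, 0, hf, by simp, by simp⟩
  | insert b s hb ih =>
    obtain ⟨q, r, hq, hr, hfr⟩ := ih (f /ₘ (X - C (a b))) fun k => by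
      rw [coeff_divByMonic_X_sub_C]
      exact Finset.sum_nonneg fun i _ => mul_nonneg (pow_nonneg (ha b) _) (hf i)
    refine ⟨q, (X - C (a b)) * r + C (f.eval (a b)), hq, ?_, ?_⟩
    · rw [Finset.card_insert_of_notMem hb]
      refine (degree_add_le _ _).trans_lt (max_lt ?_ ?_)
      · rcases eq_or_ne r 0 with rfl | hr0
        · simp only [mul_zero, degree_zero]
          exact WithBot.bot_lt_coe _
        · rw [degree_mul, degree_X_sub_C, degree_eq_natDegree hr0] at *
          norm_cast at *
          omega
      · refine degree_C_le.trans_lt ?_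
        norm_cast
        omega
    · have h1 := modByMonic_add_div f (X - C (a b))
      rw [modByMonic_X_sub_C_eq_C_eval, hfr] at h1
      rw [Finset.prod_insert hb]
      linear_combination -h1

/-- Polynomials are integrable against the standard Gaussian weight. -/
lemma integrable_eval_mul_exp (p : Polynomial ℝ) :
    Integrable fun t : ℝ => p.eval t * Real.exp (-t ^ 2 / 2) := by
  have h1 : ∀ i : ℕ, Integrable fun t : ℝ => t ^ i * Real.exp (-t ^ 2 / 2) := fun i => by
    have := integrable_rpow_mul_exp_neg_mul_sq (b := 1 / 2) (by norm_num)
      (s := i) (by linarith [(Nat.cast_nonneg i : (0 : ℝ) ≤ i)])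
    refine this.congr (Eventually.of_forall fun t => ?_)
    simp only [Real.rpow_natCast]
    congr 2
    ring
  have h2 : (fun t : ℝ => p.eval t * Real.exp (-t ^ 2 / 2)) = fun t =>
      ∑ i ∈ Finset.range (p.natDegree + 1), p.coeff i * (t ^ i * Real.exp (-t ^ 2 / 2)) := by
    ext t
    rw [Polynomial.eval_eq_sum_range, Finset.sum_mul]
    exact Finset.sum_congr rfl fun i _ => by ring
  rw [h2]
  exact integrable_finsetSum _ fun i _ => (h1 i).const_mul _

/-- The Gauss–Hermite rule underestimates polynomials in `t ^ 2` with nonnegative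
coefficients. -/
lemma IsGaussHermite.sum_eval_sq_le {n : ℕ} (hn : 1 ≤ n) {x w : Fin n → ℝ}
    (h : IsGaussHermite n x w) (f : Polynomial ℝ) (hf : ∀ k, 0 ≤ f.coeff k) :
    ∑ i, w i * f.eval (x i ^ 2) ≤
      (Real.sqrt (2 * Real.pi))⁻¹ * ∫ t : ℝ, f.eval (t ^ 2) * Real.exp (-t ^ 2 / 2) := by
  obtain ⟨q, r, hq, hr, hfr⟩ := exists_quotient_coeff_nonneg Finset.univ (fun i => x i ^ 2)
    (fun i => sq_nonneg _) f hf
  have hev : ∀ t, f.eval t = q.eval t * (∏ i, (t - x i ^ 2)) + r.eval t := fun t => by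
    rw [hfr]
    simp [Polynomial.eval_prod]
  have hrd : r.natDegree < n := by
    rcases eq_or_ne r 0 with rfl | h0
    · rw [Polynomial.natDegree_zero]
      omega
    · rw [Polynomial.natDegree_lt_iff_degree_lt h0]
      simpa using hr
  have hr2 := h.2.2.2 (r.comp (Polynomial.X ^ 2)) (by
    rw [Polynomial.natDegree_comp, Polynomial.natDegree_X_pow]
    omega)
  have e1 : ∑ i, w i * f.eval (x i ^ 2)
      = ∑ i, w i * (r.comp (Polynomial.X ^ 2)).eval (x i) := by
    refine Finset.sum_congr rfl fun i _ => ?_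
    rw [hev, Finset.prod_eq_zero (Finset.mem_univ i) (sub_self _)]
    simp
  rw [e1, hr2]
  refine mul_le_mul_of_nonneg_left (integral_mono (integrable_eval_mul_exp _) ?_ fun t => ?_)
    (by positivity)
  · refine (integrable_eval_mul_exp (f.comp (Polynomial.X ^ 2))).congr
      (Eventually.of_forall fun t => ?_)
    simp only [Polynomial.eval_comp, Polynomial.eval_pow, Polynomial.eval_X]
  · simp only [Polynomial.eval_comp, Polynomial.eval_pow, Polynomial.eval_X]
    refine mul_le_mul_of_nonneg_right ?_ (Real.exp_pos _).le
    rw [hev]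
    have hq0 : 0 ≤ q.eval (t ^ 2) := by
      rw [Polynomial.eval_eq_sum_range]
      exact Finset.sum_nonneg fun i _ => mul_nonneg (hq i) (by positivity)
    have := mul_nonneg hq0 (h.prod_sq_sub_nonneg t)
    linarith

/-- The Gauss–Hermite rule annihilates odd powers. -/
lemma IsGaussHermite.sum_odd_pow {n : ℕ} (hn : 1 ≤ n) {x w : Fin n → ℝ}
    (h : IsGaussHermite n x w) (k : ℕ) : ∑ i, w i * x i ^ (2 * k + 1) = 0 := by
  obtain ⟨q, r, -, hr, hfr⟩ := exists_quotient_coeff_nonneg Finset.univ (fun i => x i ^ 2)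
    (fun i => sq_nonneg _) (Polynomial.X ^ k) (fun m => by
      rw [Polynomial.coeff_X_pow]; split_ifs <;> norm_num)
  have hev : ∀ t : ℝ, t ^ k = q.eval t * (∏ i, (t - x i ^ 2)) + r.eval t := fun t => by
    have := congrArg (Polynomial.eval t) hfr
    simpa [Polynomial.eval_prod] using this
  have hrd : r.natDegree < n := by
    rcases eq_or_ne r 0 with rfl | h0
    · rw [Polynomial.natDegree_zero]
      omega
    · rw [Polynomial.natDegree_lt_iff_degree_lt h0]
      simpa using hr
  have hr2 := h.2.2.2 (Polynomial.X * r.comp (Polynomial.X ^ 2)) (by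
    refine Polynomial.natDegree_mul_le.trans ?_
    rw [Polynomial.natDegree_comp, Polynomial.natDegree_X_pow, Polynomial.natDegree_X]
    omega)
  have e1 : ∑ i, w i * x i ^ (2 * k + 1)
      = ∑ i, w i * (Polynomial.X * r.comp (Polynomial.X ^ 2)).eval (x i) := by
    refine Finset.sum_congr rfl fun i _ => ?_
    rw [pow_succ, pow_mul, hev, Finset.prod_eq_zero (Finset.mem_univ i) (sub_self _)]
    simp [mul_comm]
  have e2 : ∫ t : ℝ, (Polynomial.X * r.comp (Polynomial.X ^ 2)).eval t *
      Real.exp (-t ^ 2 / 2) = 0 := by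
    have h1 := integral_neg_eq_self (fun t : ℝ =>
      (Polynomial.X * r.comp (Polynomial.X ^ 2)).eval t * Real.exp (-t ^ 2 / 2)) volume
    simp only [Polynomial.eval_mul, Polynomial.eval_X, Polynomial.eval_comp, Polynomial.eval_pow,
      neg_sq, neg_mul, integral_neg] at h1 ⊢
    linarith
  rw [e1, hr2, e2, mul_zero]

/-- The Gauss–Hermite rule underestimates power series in `t ^ 2` with nonnegative
coefficients. -/
lemma IsGaussHermite.sum_le_integral_of_hasSum {n : ℕ} (hn : 1 ≤ n) {x w : Fin n → ℝ}
    (h : IsGaussHermite n x w) (c : ℕ → ℝ) (hc : ∀ k, 0 ≤ c k) (g : ℝ → ℝ)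
    (hg : ∀ t, HasSum (fun k => c k * (t ^ 2) ^ k) (g t))
    (hgi : Integrable fun t => g t * Real.exp (-t ^ 2 / 2)) :
    ∑ i, w i * g (x i) ≤
      (Real.sqrt (2 * Real.pi))⁻¹ * ∫ t : ℝ, g t * Real.exp (-t ^ 2 / 2) := by
  have hs : HasSum (fun k => ∑ i, w i * (c k * (x i ^ 2) ^ k)) (∑ i, w i * g (x i)) :=
    hasSum_sum fun i _ => (hg (x i)).mul_left _
  refine le_of_tendsto' hs.tendsto_sum_nat fun N => ?_
  set f : Polynomial ℝ := ∑ k ∈ Finset.range N, Polynomial.C (c k) * Polynomial.X ^ k with hf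
  have hfe : ∀ t, f.eval t = ∑ k ∈ Finset.range N, c k * t ^ k := fun t => by
    simp [hf, Polynomial.eval_finsetSum]
  have hfc : ∀ k, 0 ≤ f.coeff k := fun k => by
    rw [hf, Polynomial.finsetSum_coeff]
    refine Finset.sum_nonneg fun m _ => ?_
    rw [Polynomial.coeff_C_mul, Polynomial.coeff_X_pow]
    split_ifs
    · simpa using hc m
    · simp
  have e1 : ∑ k ∈ Finset.range N, ∑ i, w i * (c k * (x i ^ 2) ^ k)
      = ∑ i, w i * f.eval (x i ^ 2) := by
    rw [Finset.sum_comm]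
    exact Finset.sum_congr rfl fun i _ => by rw [hfe, Finset.mul_sum]
  rw [e1]
  refine (h.sum_eval_sq_le hn f hfc).trans
    (mul_le_mul_of_nonneg_left (integral_mono ?_ hgi fun t => ?_) (by positivity))
  · refine (integrable_eval_mul_exp (f.comp (Polynomial.X ^ 2))).congr
      (Eventually.of_forall fun t => ?_)
    simp only [Polynomial.eval_comp, Polynomial.eval_pow, Polynomial.eval_X]
  · refine mul_le_mul_of_nonneg_right ?_ (Real.exp_pos _).le
    rw [hfe]
    exact sum_le_hasSum _ (fun k _ => mul_nonneg (hc k) (by positivity)) (hg t)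

/-- A shifted and rescaled Gaussian integral. -/
lemma integral_const_mul_exp_neg_mul_sub_sq (a b c : ℝ) :
    ∫ t : ℝ, a * Real.exp (-b * (t - c) ^ 2) = a * Real.sqrt (Real.pi / b) := by
  rw [integral_const_mul, integral_sub_right_eq_self (fun t : ℝ => Real.exp (-b * t ^ 2)) c,
    integral_gaussian]

/-- Shifted and rescaled Gaussians are integrable. -/
lemma integrable_const_mul_exp_neg_mul_sub_sq (a b c : ℝ) (hb : 0 < b) :
    Integrable fun t : ℝ => a * Real.exp (-b * (t - c) ^ 2) :=
  ((integrable_exp_neg_mul_sq hb).comp_sub_right c).const_mul a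

/-- Completing the square in the Gaussian moment generating function. -/
lemma exp_mul_mul_exp_neg_sq (s t : ℝ) :
    Real.exp (s * t) * Real.exp (-t ^ 2 / 2)
      = Real.exp (s ^ 2 / 2) * Real.exp (-(1 / 2) * (t - s) ^ 2) := by
  rw [← Real.exp_add, ← Real.exp_add]
  ring_nf

/-- The Gauss–Hermite rule underestimates the Gaussian moment generating function. -/
lemma IsGaussHermite.sum_exp_mul_le {n : ℕ} (hn : 1 ≤ n) {x w : Fin n → ℝ}
    (h : IsGaussHermite n x w) (s : ℝ) :
    ∑ i, w i * Real.exp (s * x i) ≤ Real.exp (s ^ 2 / 2) := by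
  have hsinh : ∑ i, w i * Real.sinh (s * x i) = 0 := by
    have h1 : HasSum (fun k : ℕ => ∑ i, w i * ((s * x i) ^ (2 * k + 1) /
        ((2 * k + 1).factorial : ℝ))) (∑ i, w i * Real.sinh (s * x i)) :=
      hasSum_sum fun i _ => (Real.hasSum_sinh (s * x i)).mul_left _
    refine h1.unique ?_
    convert hasSum_zero using 2 with k
    have h2 := h.sum_odd_pow hn k
    calc _ = s ^ (2 * k + 1) / ((2 * k + 1).factorial : ℝ) * ∑ i, w i * x i ^ (2 * k + 1) := by
          rw [Finset.mul_sum]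
          exact Finset.sum_congr rfl fun i _ => by rw [mul_pow]; ring
      _ = 0 := by rw [h2, mul_zero]
  have hE : ∀ u : ℝ, (∫ t : ℝ, Real.exp (u * t) * Real.exp (-t ^ 2 / 2))
      = Real.exp (u ^ 2 / 2) * Real.sqrt (2 * Real.pi) := fun u => by
    simp_rw [exp_mul_mul_exp_neg_sq]
    rw [integral_const_mul_exp_neg_mul_sub_sq]
    congr 2
    ring
  have hI : ∀ u : ℝ, Integrable fun t : ℝ => Real.exp (u * t) * Real.exp (-t ^ 2 / 2) :=
    fun u => by
      simp_rw [exp_mul_mul_exp_neg_sq]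
      exact integrable_const_mul_exp_neg_mul_sub_sq _ _ _ (by norm_num)
  have hcosh : (fun t : ℝ => Real.cosh (s * t) * Real.exp (-t ^ 2 / 2)) = fun t =>
      (1 / 2) * (Real.exp (s * t) * Real.exp (-t ^ 2 / 2) +
        Real.exp (-s * t) * Real.exp (-t ^ 2 / 2)) := by
    ext t
    rw [Real.cosh_eq, neg_mul]
    ring
  have hc := h.sum_le_integral_of_hasSum hn
    (fun k => s ^ (2 * k) / ((2 * k).factorial : ℝ))
    (fun k => div_nonneg (by rw [pow_mul]; positivity) (by positivity))
    (fun t => Real.cosh (s * t)) (fun t => by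
      convert Real.hasSum_cosh (s * t) using 2 with k
      rw [mul_pow, ← pow_mul]
      ring) (by
      rw [hcosh]
      exact ((hI s).add (hI (-s))).const_mul _)
  rw [hcosh, integral_const_mul, integral_add (hI s) (hI (-s)), hE, hE] at hc
  have hpos : Real.sqrt (2 * Real.pi) ≠ 0 := by positivity
  calc ∑ i, w i * Real.exp (s * x i)
      = ∑ i, w i * Real.cosh (s * x i) + ∑ i, w i * Real.sinh (s * x i) := by
        rw [← Finset.sum_add_distrib]
        exact Finset.sum_congr rfl fun i _ => by rw [← mul_add, Real.cosh_add_sinh]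
    _ ≤ _ := by
        rw [hsinh, add_zero]
        refine hc.trans (le_of_eq ?_)
        rw [neg_sq]
        field_simp
        ring

/-- The Gauss–Hermite rule underestimates the Gaussian integral of `exp (c t ^ 2 / 2)`. -/
lemma IsGaussHermite.sum_exp_sq_le {n : ℕ} (hn : 1 ≤ n) {x w : Fin n → ℝ}
    (h : IsGaussHermite n x w) (c : ℝ) (hc0 : 0 ≤ c) (hc1 : c < 1) :
    ∑ i, w i * Real.exp (c * x i ^ 2 / 2) ≤ (Real.sqrt (1 - c))⁻¹ := by
  have e : (fun t : ℝ => Real.exp (c * t ^ 2 / 2) * Real.exp (-t ^ 2 / 2))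
      = fun t => Real.exp (-((1 - c) / 2) * t ^ 2) := by
    ext t
    rw [← Real.exp_add]
    ring_nf
  have hs := h.sum_le_integral_of_hasSum hn (fun k => (c / 2) ^ k / (k.factorial : ℝ))
    (fun k => by positivity) (fun t => Real.exp (c * t ^ 2 / 2)) (fun t => by
      have := NormedSpace.expSeries_div_hasSum_exp (c * t ^ 2 / 2)
      rw [← Real.exp_eq_exp_ℝ] at this
      have hk : ∀ k : ℕ, (c * t ^ 2 / 2) ^ k / (k.factorial : ℝ)
          = (c / 2) ^ k / (k.factorial : ℝ) * (t ^ 2) ^ k := fun k => by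
        rw [show c * t ^ 2 / 2 = (c / 2) * t ^ 2 by ring, mul_pow]
        ring
      simpa only [hk] using this) (by
      rw [e]
      exact integrable_exp_neg_mul_sq (by linarith))
  rw [e, integral_gaussian] at hs
  refine hs.trans (le_of_eq ?_)
  have h1 : Real.pi / ((1 - c) / 2) = (2 * Real.pi) / (1 - c) := by
    field_simp
  have hpos : Real.sqrt (2 * Real.pi) ≠ 0 := by positivity
  rw [h1, Real.sqrt_div (by positivity)]
  field_simp

/-- The Gaussian integral of a Gaussian kernel translate. -/
lemma gaussian_kernel_mean {α ℓ : ℝ} (hα : 0 < α) (hℓ : 0 < ℓ) (s : ℝ) :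
    ∫ t : ℝ, Real.exp (-(t - s) ^ 2 / (2 * ℓ ^ 2)) * Real.exp (-t ^ 2 / (2 * α ^ 2))
      = Real.sqrt (2 * Real.pi) * α * (Real.sqrt (ℓ ^ 2 / (α ^ 2 + ℓ ^ 2)) *
        Real.exp (-s ^ 2 / (2 * (α ^ 2 + ℓ ^ 2)))) := by
  have e : ∀ t : ℝ, Real.exp (-(t - s) ^ 2 / (2 * ℓ ^ 2)) * Real.exp (-t ^ 2 / (2 * α ^ 2))
      = Real.exp (-s ^ 2 / (2 * (α ^ 2 + ℓ ^ 2))) *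
        Real.exp (-((α ^ 2 + ℓ ^ 2) / (2 * α ^ 2 * ℓ ^ 2)) *
          (t - α ^ 2 * s / (α ^ 2 + ℓ ^ 2)) ^ 2) := fun t => by
    rw [← Real.exp_add, ← Real.exp_add]
    congr 1
    field_simp
    ring
  simp_rw [e]
  rw [integral_const_mul_exp_neg_mul_sub_sq]
  have h1 : Real.pi / ((α ^ 2 + ℓ ^ 2) / (2 * α ^ 2 * ℓ ^ 2))
      = 2 * Real.pi * (α ^ 2 * (ℓ ^ 2 / (α ^ 2 + ℓ ^ 2))) := by
    field_simp
  rw [h1, Real.sqrt_mul (by positivity), Real.sqrt_mul (sq_nonneg α), Real.sqrt_sq hα.le]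
  ring

/-- the squared RKHS norm of the scaled Gauss–Hermite representer is at most
that of the integral representer, with the explicit Gaussian integral identities. -/
theorem stmt6 (α ℓ : ℝ) (hα : 0 < α) (hℓ : 0 < ℓ) (n : ℕ) (hn : 1 ≤ n)
    (x w : Fin n → ℝ) (hGH : IsGaussHermite n x w) :
    (∑ i, ∑ j,
        (betaP α ℓ / α * w i * Real.exp (betaP α ℓ ^ 2 * x i ^ 2 / (2 * ℓ ^ 2))) *
          (betaP α ℓ / α * w j * Real.exp (betaP α ℓ ^ 2 * x j ^ 2 / (2 * ℓ ^ 2))) *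
          Real.exp (-(betaP α ℓ * x i - betaP α ℓ * x j) ^ 2 / (2 * ℓ ^ 2))
      ≤ (1 + 2 * α ^ 2 / ℓ ^ 2) ^ (-(1 / 2 : ℝ))) ∧
    ((2 * Real.pi * α ^ 2)⁻¹ *
        ∫ s : ℝ, ∫ t : ℝ, Real.exp (-(s - t) ^ 2 / (2 * ℓ ^ 2)) *
          Real.exp (-s ^ 2 / (2 * α ^ 2)) * Real.exp (-t ^ 2 / (2 * α ^ 2))
      = (1 + 2 * α ^ 2 / ℓ ^ 2) ^ (-(1 / 2 : ℝ))) ∧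
    ∀ s : ℝ, (Real.sqrt (2 * Real.pi) * α)⁻¹ *
        ∫ t : ℝ, Real.exp (-(t - s) ^ 2 / (2 * ℓ ^ 2)) * Real.exp (-t ^ 2 / (2 * α ^ 2))
      = Real.sqrt (ℓ ^ 2 / (α ^ 2 + ℓ ^ 2)) * Real.exp (-s ^ 2 / (2 * (α ^ 2 + ℓ ^ 2))) := by
  have hβ : betaP α ℓ ^ 2 = α ^ 2 * ℓ ^ 2 / (α ^ 2 + ℓ ^ 2) := by
    rw [betaP, div_pow, Real.sq_sqrt (by positivity), mul_pow]
  have hnorm : (1 + 2 * α ^ 2 / ℓ ^ 2) ^ (-(1 / 2 : ℝ))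
      = (Real.sqrt (1 + 2 * α ^ 2 / ℓ ^ 2))⁻¹ := by
    rw [Real.rpow_neg (by positivity), Real.sqrt_eq_rpow]
  have hmean := gaussian_kernel_mean hα hℓ
  refine ⟨?_, ?_, fun s => ?_⟩
  · set r : ℝ := α ^ 2 / (α ^ 2 + ℓ ^ 2) with hr
    have hr0 : 0 < r := by positivity
    have hr1 : r < 1 := by
      rw [hr, div_lt_one (by positivity)]
      nlinarith [sq_pos_of_pos hℓ]
    have hβr : betaP α ℓ ^ 2 = r * ℓ ^ 2 := by rw [hβ, hr]; ring
    have hβα : (betaP α ℓ / α) ^ 2 = 1 - r := by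
      rw [div_pow, hβ, hr]
      field_simp
      ring
    have hterm : ∀ i j,
        (betaP α ℓ / α * w i * Real.exp (betaP α ℓ ^ 2 * x i ^ 2 / (2 * ℓ ^ 2))) *
          (betaP α ℓ / α * w j * Real.exp (betaP α ℓ ^ 2 * x j ^ 2 / (2 * ℓ ^ 2))) *
          Real.exp (-(betaP α ℓ * x i - betaP α ℓ * x j) ^ 2 / (2 * ℓ ^ 2))
        = (1 - r) * (w i * (w j * Real.exp (r * x i * x j))) := fun i j => by
      have he : Real.exp (r * x i * x j) = Real.exp (betaP α ℓ ^ 2 * x i ^ 2 / (2 * ℓ ^ 2)) *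
          Real.exp (betaP α ℓ ^ 2 * x j ^ 2 / (2 * ℓ ^ 2)) *
          Real.exp (-(betaP α ℓ * x i - betaP α ℓ * x j) ^ 2 / (2 * ℓ ^ 2)) := by
        rw [← Real.exp_add, ← Real.exp_add, ← mul_sub, mul_pow, hβr]
        congr 1
        field_simp
        ring
      rw [he, ← hβα]
      ring
    simp_rw [hterm, ← Finset.mul_sum]
    have h1 : ∑ i, w i * ∑ j, w j * Real.exp (r * x i * x j) ≤ (Real.sqrt (1 - r ^ 2))⁻¹ := by
      refine le_trans (Finset.sum_le_sum fun i _ => mul_le_mul_of_nonneg_left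
        (hGH.sum_exp_mul_le hn (r * x i)) (hGH.2.2.1 i).le) ?_
      simp_rw [mul_pow]
      exact hGH.sum_exp_sq_le hn (r ^ 2) (by positivity) (by nlinarith)
    refine (mul_le_mul_of_nonneg_left h1 (by linarith)).trans (le_of_eq ?_)
    have h2 : 1 - r ^ 2 = (1 - r) ^ 2 * (1 + 2 * α ^ 2 / ℓ ^ 2) := by
      rw [hr]
      field_simp
      ring
    have h3 : 1 - r ≠ 0 := by linarith
    rw [hnorm, h2, Real.sqrt_mul (by positivity), Real.sqrt_sq (by linarith), mul_inv,
      mul_inv_cancel_left₀ h3]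
  · have e1 : ∀ s t : ℝ, Real.exp (-(s - t) ^ 2 / (2 * ℓ ^ 2)) *
          Real.exp (-s ^ 2 / (2 * α ^ 2)) * Real.exp (-t ^ 2 / (2 * α ^ 2))
        = Real.exp (-s ^ 2 / (2 * α ^ 2)) *
          (Real.exp (-(t - s) ^ 2 / (2 * ℓ ^ 2)) * Real.exp (-t ^ 2 / (2 * α ^ 2))) :=
      fun s t => by
        rw [← neg_sub t s, neg_sq]
        ring
    simp_rw [e1, integral_const_mul, hmean]
    have e2 : ∀ s : ℝ, Real.exp (-s ^ 2 / (2 * α ^ 2)) * (Real.sqrt (2 * Real.pi) * α *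
          (Real.sqrt (ℓ ^ 2 / (α ^ 2 + ℓ ^ 2)) * Real.exp (-s ^ 2 / (2 * (α ^ 2 + ℓ ^ 2)))))
        = Real.sqrt (2 * Real.pi) * α * Real.sqrt (ℓ ^ 2 / (α ^ 2 + ℓ ^ 2)) *
          (Real.exp (-(s - 0) ^ 2 / (2 * (Real.sqrt (α ^ 2 + ℓ ^ 2)) ^ 2)) *
            Real.exp (-s ^ 2 / (2 * α ^ 2))) := fun s => by
      rw [Real.sq_sqrt (by positivity), sub_zero]
      ring
    simp_rw [e2, integral_const_mul]
    rw [gaussian_kernel_mean hα (by positivity) 0, Real.sq_sqrt (by positivity), hnorm]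
    have h1 : Real.sqrt (ℓ ^ 2 / (α ^ 2 + ℓ ^ 2)) *
        Real.sqrt ((α ^ 2 + ℓ ^ 2) / (α ^ 2 + (α ^ 2 + ℓ ^ 2)))
        = (Real.sqrt (1 + 2 * α ^ 2 / ℓ ^ 2))⁻¹ := by
      rw [← Real.sqrt_mul (by positivity), ← Real.sqrt_inv]
      congr 1
      field_simp
      ring
    have h2 : Real.sqrt (2 * Real.pi) ^ 2 = 2 * Real.pi := Real.sq_sqrt (by positivity)
    rw [← h1]
    have h3 : Real.sqrt (2 * Real.pi) ≠ 0 := by positivity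
    simp only [ne_eq, OfNat.ofNat_ne_zero, not_false_eq_true, zero_pow, neg_zero, zero_div,
      Real.exp_zero, mul_one]
    generalize Real.sqrt (2 * Real.pi) = p at *
    rw [← h2]
    generalize Real.sqrt (ℓ ^ 2 / (α ^ 2 + ℓ ^ 2)) = a
    generalize Real.sqrt ((α ^ 2 + ℓ ^ 2) / (α ^ 2 + (α ^ 2 + ℓ ^ 2))) = b
    field_simp
  · rw [hmean, inv_mul_cancel_left₀ (by positivity)]

end
end

section
/- For every n ≥ 1 and every t ∈ ℝ, the n-point Gauss–Hermite rule underestimates the Gaussian moment generating function: Σ_{j=1}^n w_{n,j} exp(t x_{n,j}) ≤ exp(t²/2) = (1/√(2π)) ∫_ℝ exp(t x) exp(−x²/2) dx. -/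
open MeasureTheory Real Filter

noncomputable section

open Polynomial ProbabilityTheory in
lemma integrable_eval_mul_exp_gaussianReal (p : ℝ[X]) (t : ℝ) :
    Integrable (fun s ↦ p.eval s * rexp (t * s)) (gaussianReal 0 1) := by
  induction p using Polynomial.induction_on' with
  | add p q hp hq =>
    simp only [eval_add, add_mul]
    exact hp.add hq
  | monomial k a =>
    have h := integrable_pow_mul_exp_of_mem_interior_integrableExpSet
      (X := fun s : ℝ ↦ s) (μ := gaussianReal 0 1) (v := t) (by simp) k
    simpa only [eval_monomial, mul_assoc] using h.const_mul a

open Polynomial ProbabilityTheory in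
lemma hasDerivAt_integral_eval_mul_exp_gaussianReal (p : ℝ[X]) (t : ℝ) :
    HasDerivAt (fun t ↦ ∫ s, p.eval s * rexp (t * s) ∂gaussianReal 0 1)
      (∫ s, (X * p).eval s * rexp (t * s) ∂gaussianReal 0 1) t := by
  induction p using Polynomial.induction_on' with
  | add p q hp hq =>
    simp only [mul_add, eval_add, add_mul]
    simp_rw [integral_add (integrable_eval_mul_exp_gaussianReal p _)
      (integrable_eval_mul_exp_gaussianReal q _)]
    rw [integral_add (integrable_eval_mul_exp_gaussianReal (X * p) _)
      (integrable_eval_mul_exp_gaussianReal (X * q) _)]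
    exact hp.add hq
  | monomial k a =>
    have h := hasDerivAt_integral_pow_mul_exp_real
      (X := fun s : ℝ ↦ s) (μ := gaussianReal 0 1) (t := t) (by simp) k
    simpa only [X_mul_monomial, eval_monomial, mul_assoc, integral_const_mul] using h.const_mul a

open ProbabilityTheory in
lemma integral_gaussianReal_zero_one (f : ℝ → ℝ) :
    ∫ s, f s ∂gaussianReal 0 1
      = (Real.sqrt (2 * Real.pi))⁻¹ * ∫ s : ℝ, f s * Real.exp (-s ^ 2 / 2) := by
  rw [integral_gaussianReal_eq_integral_smul one_ne_zero, ← integral_const_mul]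
  refine integral_congr_ae (ae_of_all _ fun s ↦ ?_)
  simp only [gaussianPDFReal_def, smul_eq_mul, NNReal.coe_one, mul_one, sub_zero]
  ring

open Polynomial ProbabilityTheory in
/-- The error of the quadrature rule with nodes `x` and weights `w` for the standard Gaussian
measure at the integrand `s ↦ p(s) exp(t s)`. -/
def gaussQuadError {ι : Type*} [Fintype ι] (x w : ι → ℝ) (p : ℝ[X]) (t : ℝ) : ℝ :=
  (∫ s, p.eval s * rexp (t * s) ∂gaussianReal 0 1) - ∑ i, w i * (p.eval (x i) * rexp (t * x i))

section GaussQuadError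

open Polynomial ProbabilityTheory

variable {ι : Type*} [Fintype ι] (x w : ι → ℝ)

lemma hasDerivAt_gaussQuadError (p : ℝ[X]) (t : ℝ) :
    HasDerivAt (gaussQuadError x w p) (gaussQuadError x w (X * p) t) t := by
  refine (hasDerivAt_integral_eval_mul_exp_gaussianReal p t).sub
    (HasDerivAt.fun_sum fun i _ ↦ ?_)
  have h := (((hasDerivAt_id t).mul_const (x i)).exp.const_mul (p.eval (x i))).const_mul (w i)
  refine h.congr_deriv ?_
  simp only [eval_mul, eval_X, id]
  ring

lemma gaussQuadError_mul_X_sub_C (p : ℝ[X]) (a t : ℝ) :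
    gaussQuadError x w (p * (X - C a)) t
      = gaussQuadError x w (X * p) t - a * gaussQuadError x w p t := by
  have h (s : ℝ) : (p * (X - C a)).eval s * rexp (t * s)
      = (X * p).eval s * rexp (t * s) - a * (p.eval s * rexp (t * s)) := by
    simp only [eval_mul, eval_sub, eval_X, eval_C]
    ring
  simp only [gaussQuadError, h]
  rw [integral_sub (integrable_eval_mul_exp_gaussianReal _ _)
    ((integrable_eval_mul_exp_gaussianReal _ _).const_mul a), integral_const_mul]
  simp only [mul_sub, Finset.sum_sub_distrib, Finset.mul_sum, mul_left_comm a]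
  ring

lemma hasDerivAt_exp_mul_gaussQuadError (p : ℝ[X]) (a t : ℝ) :
    HasDerivAt (fun t ↦ rexp (-a * t) * gaussQuadError x w p t)
      (rexp (-a * t) * gaussQuadError x w (p * (X - C a)) t) t := by
  have h := ((hasDerivAt_id t).const_mul (-a)).exp.mul (hasDerivAt_gaussQuadError x w p t)
  refine h.congr_deriv ?_
  rw [gaussQuadError_mul_X_sub_C]
  simp only [id]
  ring

lemma gaussQuadError_nonneg_of_mul_sq {p : ℝ[X]} {a : ℝ} (h₀ : gaussQuadError x w p 0 = 0)
    (h₁ : gaussQuadError x w (p * (X - C a)) 0 = 0)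
    (h₂ : ∀ t, 0 ≤ gaussQuadError x w (p * (X - C a) ^ 2) t) (t : ℝ) :
    0 ≤ gaussQuadError x w p t := by
  have hd₀ := hasDerivAt_exp_mul_gaussQuadError x w p a
  have hmono : Monotone fun t ↦ rexp (-a * t) * gaussQuadError x w (p * (X - C a)) t := by
    refine monotone_of_hasDerivAt_nonneg
      (hasDerivAt_exp_mul_gaussQuadError x w (p * (X - C a)) a) fun t ↦ ?_
    rw [mul_assoc p, ← pow_two]
    exact mul_nonneg (exp_pos _).le (h₂ t)
  have hconv : ConvexOn ℝ Set.univ fun t ↦ rexp (-a * t) * gaussQuadError x w p t := by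
    refine Monotone.convexOn_univ_of_deriv (fun t ↦ (hd₀ t).differentiableAt) ?_
    rwa [deriv_eq hd₀]
  have hright := (hd₀ 0).hasDerivWithinAt.derivWithin (uniqueDiffWithinAt_Ioi 0)
  rw [h₁, mul_zero] at hright
  have hmin := hconv.isMinOn_of_rightDeriv_eq_zero (by simp) hright (Set.mem_univ t)
  simp only [Set.mem_ofPred_eq, h₀, mul_zero] at hmin
  exact nonneg_of_mul_nonneg_right hmin (exp_pos _)

lemma gaussQuadError_nonneg_of_mul_prod_sq {N : ℕ}
    (hexact : ∀ p : ℝ[X], p.natDegree ≤ N → gaussQuadError x w p 0 = 0)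
    (S : Finset ι) (p : ℝ[X]) (hdeg : p.natDegree + 2 * S.card ≤ N + 1)
    (hp : ∀ t, 0 ≤ gaussQuadError x w (p * ∏ i ∈ S, (X - C (x i)) ^ 2) t) (t : ℝ) :
    0 ≤ gaussQuadError x w p t := by
  classical
  induction S using Finset.induction_on generalizing p t with
  | empty => simpa using hp t
  | insert a S ha ih =>
    rw [Finset.card_insert_of_notMem ha] at hdeg
    have h₁ : (p * (X - C (x a))).natDegree ≤ p.natDegree + 1 :=
      natDegree_mul_le.trans (by simp)
    have h₂ : (p * (X - C (x a)) ^ 2).natDegree ≤ p.natDegree + 2 :=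
      natDegree_mul_le.trans (by simp)
    refine gaussQuadError_nonneg_of_mul_sq x w (a := x a) (hexact _ (by omega)) (hexact _ (by omega))
      (ih _ (by omega) fun t ↦ ?_) t
    simpa only [Finset.prod_insert ha, mul_assoc] using hp t

lemma gaussQuadError_prod_sq_nonneg (t : ℝ) :
    0 ≤ gaussQuadError x w (∏ i, (X - C (x i)) ^ 2) t := by
  have hnode (i : ι) : (∏ j, (X - C (x j)) ^ 2 : ℝ[X]).eval (x i) = 0 := by
    rw [eval_prod]
    exact Finset.prod_eq_zero (Finset.mem_univ i) (by simp)
  simp only [gaussQuadError, hnode, zero_mul, mul_zero, Finset.sum_const_zero, sub_zero]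
  refine integral_nonneg fun s ↦ mul_nonneg ?_ (exp_pos _).le
  rw [eval_prod]
  exact Finset.prod_nonneg fun i _ ↦ by simpa using sq_nonneg (s - x i)

end GaussQuadError

/-- the Gauss–Hermite rule underestimates the Gaussian moment generating
function. -/
theorem stmt7 (n : ℕ) (hn : 1 ≤ n) (x w : Fin n → ℝ) (hGH : IsGaussHermite n x w) (t : ℝ) :
    (∑ j, w j * Real.exp (t * x j) ≤ Real.exp (t ^ 2 / 2)) ∧
    Real.exp (t ^ 2 / 2)
      = (Real.sqrt (2 * Real.pi))⁻¹ * ∫ s : ℝ, Real.exp (t * s) * Real.exp (-s ^ 2 / 2) := by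
  have hmgf : ∫ s, rexp (t * s) ∂ProbabilityTheory.gaussianReal 0 1 = rexp (t ^ 2 / 2) := by
    simpa [ProbabilityTheory.mgf] using
      congrFun (ProbabilityTheory.mgf_fun_id_gaussianReal (μ := 0) (v := 1)) t
  refine ⟨?_, by rw [← hmgf, integral_gaussianReal_zero_one]⟩
  have hexact (p : Polynomial ℝ) (hp : p.natDegree ≤ 2 * n - 1) : gaussQuadError x w p 0 = 0 := by
    simp [gaussQuadError, integral_gaussianReal_zero_one, hGH.2.2.2 p hp]
  have h := gaussQuadError_nonneg_of_mul_prod_sq x w hexact Finset.univ 1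
    (by simp only [Polynomial.natDegree_one, Finset.card_univ, Fintype.card_fin]; omega)
    (by simpa only [one_mul] using gaussQuadError_prod_sq_nonneg x w) t
  simpa only [gaussQuadError, Polynomial.eval_one, one_mul, hmgf, sub_nonneg] using h

end
end
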